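/- There exists a contractible one-dimensional compact space that is not embeddable in the plane: for a triod T and a point x ∈ T, the compact space N = T × ({0} ∪ {1/k : k ∈ ℕ, k ≥ 1}) ∪ ({x} × [0,1]) ⊂ T × [0,1] is contractible and one-dimensional, yet there is no topological embedding of N into ℝ². -/

import Mathlib

/-!
STATEMENT 14: for a triod T and a point x ∈ T, the compact space
N = T × ({0} ∪ {1/k : k ≥ 1}) ∪ ({x} × [0,1])  ⊂ T × [0,1]
is contractible and one-dimensional, yet there is no topological embedding of N
into ℝ².

Here T is the standard triod in the plane (three segments with exactly one
common point, an endpoint of each), and one-dimensionality is expressed as in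
the statement: the compact space admits arbitrarily fine open covers in which
no three members intersect.
-/

open Set

/-- The standard triod: three segments in the plane with a single common endpoint. -/
def stdTriod : Set (ℝ × ℝ) :=
  segment ℝ (0, 0) (1, 0) ∪ segment ℝ (0, 0) (-1, 0) ∪ segment ℝ (0, 0) (0, 1)

/-- The convergent sequence {0} ∪ {1/k : k ∈ ℕ, k ≥ 1} ⊆ [0,1]. -/
def seqSet : Set ℝ := {0} ∪ Set.range fun k : ℕ => (1 : ℝ) / (k + 1)

/-- The space N = T × ({0} ∪ {1/k}) ∪ {x} × [0,1], inside T × [0,1] ⊂ ℝ² × ℝ. -/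
def weirdSpace (x : ℝ × ℝ) : Set ((ℝ × ℝ) × ℝ) :=
  (stdTriod ×ˢ seqSet) ∪ ({x} ×ˢ Icc (0 : ℝ) 1)

theorem mem_stdTriod {p : ℝ × ℝ} :
    p ∈ stdTriod ↔ p.2 = 0 ∧ -1 ≤ p.1 ∧ p.1 ≤ 1 ∨ p.1 = 0 ∧ 0 ≤ p.2 ∧ p.2 ≤ 1 := by
  obtain ⟨a, b⟩ := p
  simp only [stdTriod, mem_union, segment_eq_image, mem_image, mem_Icc, Prod.smul_mk, Prod.mk_add_mk,
    Prod.mk.injEq, smul_eq_mul]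
  constructor
  · rintro ((⟨θ, ⟨h0, h1⟩, rfl, rfl⟩ | ⟨θ, ⟨h0, h1⟩, rfl, rfl⟩) | ⟨θ, ⟨h0, h1⟩, rfl, rfl⟩)
    · left; refine ⟨by ring, by linarith, by linarith⟩
    · left; refine ⟨by ring, by linarith, by linarith⟩
    · right; refine ⟨by ring, by linarith, by linarith⟩
  · rintro (⟨rfl, h0, h1⟩ | ⟨rfl, h0, h1⟩)
    · rcases le_total 0 a with h | h
      · exact Or.inl (Or.inl ⟨a, ⟨h, h1⟩, by ring, by ring⟩)
      · exact Or.inl (Or.inr ⟨-a, ⟨by linarith, by linarith⟩, by ring, by ring⟩)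
    · exact Or.inr ⟨b, ⟨h0, h1⟩, by ring, by ring⟩

theorem isCompact_segment_real {E : Type*} [AddCommGroup E] [Module ℝ E] [TopologicalSpace E]
    [IsTopologicalAddGroup E] [ContinuousSMul ℝ E] (a b : E) : IsCompact (segment ℝ a b) := by
  rw [segment_eq_image]
  exact isCompact_Icc.image (by fun_prop)

theorem isCompact_stdTriod : IsCompact stdTriod :=
  ((isCompact_segment_real _ _).union (isCompact_segment_real _ _)).union
    (isCompact_segment_real _ _)

theorem isCompact_seqSet : IsCompact seqSet :=
  (tendsto_one_div_add_atTop_nhds_zero_nat (𝕜 := ℝ)).isCompact_insert_range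

theorem isCompact_weirdSpace (x : ℝ × ℝ) : IsCompact (weirdSpace x) :=
  (isCompact_stdTriod.prod isCompact_seqSet).union (isCompact_singleton.prod isCompact_Icc)

theorem starConvex_stdTriod : StarConvex ℝ 0 stdTriod :=
  ((convex_segment _ _).starConvex (left_mem_segment ℝ _ _)).union
    ((convex_segment _ _).starConvex (left_mem_segment ℝ _ _)) |>.union
    ((convex_segment _ _).starConvex (left_mem_segment ℝ _ _))

theorem zero_mem_stdTriod : (0 : ℝ × ℝ) ∈ stdTriod := by
  simp [mem_stdTriod]

instance : ContractibleSpace stdTriod :=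
  starConvex_stdTriod.contractibleSpace ⟨0, zero_mem_stdTriod⟩

instance : CompactSpace stdTriod := isCompact_iff_compactSpace.mp isCompact_stdTriod

open unitInterval in
theorem exists_continuous_log {A : Type*} [TopologicalSpace A] [ContractibleSpace A] (h : C(A, ℂ))
    (h0 : ∀ a, h a ≠ 0) : ∃ L : C(A, ℂ), ∀ a, Complex.exp (L a) = h a := by
  obtain ⟨a₀, ⟨F⟩⟩ := id_nullhomotopic A
  let H : C(I × A, {z : ℂ // z ≠ 0}) :=
    ⟨fun q => ⟨h (F.symm q), h0 _⟩, by fun_prop⟩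
  let L₀ : C(A, ℂ) := .const A (Complex.log (h a₀))
  have H0 : ∀ a, H (0, a) = ⟨Complex.exp (L₀ a), Complex.exp_ne_zero _⟩ := fun a => by
    ext
    simp [H, L₀, Complex.exp_log (h0 a₀)]
  let G := Complex.isCoveringMap_exp.liftHomotopy H L₀ H0
  refine ⟨⟨fun a => G (1, a), by fun_prop⟩, fun a => ?_⟩
  have hlift : Complex.exp (G (1, a)) = (H (1, a) : ℂ) := congrArg Subtype.val
    (congrFun (Complex.isCoveringMap_exp.liftHomotopy_lifts H L₀ H0) (1, a))
  simpa [H] using hlift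

open unitInterval in
/-- If `f` separates the two points of a pair throughout a motion that interchanges them,
then no map close to `f` on a contractible space has image disjoint from that of `f`:
otherwise the argument of `f s - g t` would be globally defined, while the argument of `f s - f t`
changes by an odd multiple of `π` along the motion. -/
theorem exists_eq_of_swap_path {X : Type*} [TopologicalSpace X] [ContractibleSpace X]
    (f g : C(X, ℂ)) (γ : C(I, X × X)) (hγ : γ 1 = (γ 0).swap)
    (hfg : ∀ s u, ‖f s - g s‖ < ‖f (γ u).1 - f (γ u).2‖) : ∃ s t, f s = g t := by
  by_contra! hne
  obtain ⟨L, hL⟩ := exists_continuous_log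
    (⟨fun q : X × X => f q.1 - g q.2, by fun_prop⟩ : C(X × X, ℂ)) fun q => sub_ne_zero.mpr (hne _ _)
  simp only [ContinuousMap.coe_mk] at hL
  let w : X × X → ℂ := fun q => (f q.1 - g q.2) / (f q.1 - f q.2)
  let ψ : X × X → ℂ := fun q => L q - Complex.log (w q)
  have slit : ∀ q : X × X, (∀ s, ‖f s - g s‖ < ‖f q.1 - f q.2‖) → w q ∈ Complex.slitPlane := by
    intro q hq
    have h0 : f q.1 - f q.2 ≠ 0 := norm_pos_iff.mp ((norm_nonneg _).trans_lt (hq q.1))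
    have e : w q = 1 + (f q.2 - g q.2) / (f q.1 - f q.2) := by
      simp only [w]; field_simp; ring
    rw [e]
    apply Complex.mem_slitPlane_of_norm_lt_one
    rw [norm_div, div_lt_one (norm_pos_iff.mpr h0)]
    exact hq _
  have expψ : ∀ q : X × X, (∀ s, ‖f s - g s‖ < ‖f q.1 - f q.2‖) →
      Complex.exp (ψ q) = f q.1 - f q.2 := by
    intro q hq
    have hw := Complex.slitPlane_ne_zero (slit q hq)
    have h1 : f q.1 - g q.2 ≠ 0 := sub_ne_zero.mpr (hne _ _)
    simp only [ψ, Complex.exp_sub, hL, Complex.exp_log hw]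
    simp only [w]
    rw [div_div_cancel₀ h1]
  have hfg' : ∀ u s, ‖f s - g s‖ < ‖f (γ u).swap.1 - f (γ u).swap.2‖ := fun u s => by
    rw [norm_sub_rev (f (γ u).swap.1)]; exact hfg s u
  have contψ : ∀ δ : C(I, X × X), (∀ u s, ‖f s - g s‖ < ‖f (δ u).1 - f (δ u).2‖) →
      Continuous fun u => ψ (δ u) := by
    intro δ hδ
    refine (by fun_prop : Continuous fun u => L (δ u)).sub (Continuous.clog ?_ fun u => slit _ (hδ u))
    refine Continuous.div (by fun_prop) (by fun_prop) fun u => ?_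
    exact norm_pos_iff.mp ((norm_nonneg _).trans_lt (hδ u (δ u).1))
  let h : I → ℂ := fun u => ψ (γ u).swap - ψ (γ u)
  have hcont : Continuous fun u => (h u).im := Complex.continuous_im.comp
    ((contψ ⟨fun u => (γ u).swap, by fun_prop⟩ hfg').sub (contψ γ fun u s => hfg s u))
  have hexp : ∀ u, Complex.exp (h u) = -1 := by
    intro u
    have h0 : f (γ u).1 - f (γ u).2 ≠ 0 :=
      norm_pos_iff.mp ((norm_nonneg _).trans_lt (hfg (γ u).1 u))
    simp only [h, Complex.exp_sub, expψ _ (hfg' u), expψ _ fun s => hfg s u, Prod.fst_swap,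
      Prod.snd_swap]
    rw [div_eq_iff h0]; ring
  have hflip : h 1 = -h 0 := by simp [h, hγ]
  have him : (h 1).im = -(h 0).im := by rw [hflip, Complex.neg_im]
  obtain ⟨u, hu⟩ : (0 : ℝ) ∈ range fun u => (h u).im := by
    rcases le_total (h 0).im 0 with h0 | h0
    · exact mem_range_of_exists_le_of_exists_ge hcont ⟨0, h0⟩ ⟨1, by rw [him]; linarith⟩
    · exact mem_range_of_exists_le_of_exists_ge hcont ⟨1, by rw [him]; linarith⟩ ⟨0, h0⟩
  have hre := congrArg Complex.re (hexp u)
  rw [Complex.exp_re, show (h u).im = 0 from hu, Real.cos_zero, mul_one, Complex.neg_re,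
    Complex.one_re] at hre
  linarith [Real.exp_pos (h u).re]

/-- Two points can be interchanged in a triod without ever meeting. -/
theorem joinedIn_swap_stdTriod :
    JoinedIn {q : (ℝ × ℝ) × (ℝ × ℝ) | q.1 ∈ stdTriod ∧ q.2 ∈ stdTriod ∧ q.1 ≠ q.2}
      ((1, 0), (-1, 0)) ((-1, 0), (1, 0)) := by
  have seg : ∀ p q : (ℝ × ℝ) × (ℝ × ℝ),
      (∀ θ : ℝ, 0 ≤ θ → θ ≤ 1 → p + θ • (q - p) ∈
        {q : (ℝ × ℝ) × (ℝ × ℝ) | q.1 ∈ stdTriod ∧ q.2 ∈ stdTriod ∧ q.1 ≠ q.2}) →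
      JoinedIn {q : (ℝ × ℝ) × (ℝ × ℝ) | q.1 ∈ stdTriod ∧ q.2 ∈ stdTriod ∧ q.1 ≠ q.2} p q := by
    intro p q h
    apply JoinedIn.of_segment_subset
    rw [segment_eq_image']
    rintro _ ⟨θ, ⟨h0, h1⟩, rfl⟩
    exact h θ h0 h1
  refine ((((((seg _ ((0, 0), (-1, 0)) ?_).trans (seg _ ((0, 1), (-1, 0)) ?_)).trans
    (seg _ ((0, 1), (0, 0)) ?_)).trans (seg _ ((0, 1), (1, 0)) ?_)).trans
    (seg _ ((0, 0), (1, 0)) ?_)).trans (seg _ _ ?_)) <;>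
  · intro θ h0 h1
    simp [mem_stdTriod]
    grind

open unitInterval Topology Filter in
theorem not_isEmbedding_weirdSpace (x : ℝ × ℝ) (φ : weirdSpace x → ℝ × ℝ) :
    ¬ IsEmbedding φ := by
  intro hφ
  let e := Complex.equivRealProdCLM.symm
  let F : C(seqSet × stdTriod, ℂ) :=
    ⟨fun q => e (φ ⟨(q.2, q.1), Or.inl ⟨q.2.2, q.1.2⟩⟩), by
      have := hφ.continuous
      fun_prop⟩
  have Finj : Function.Injective F := by
    rintro ⟨t, s⟩ ⟨t', s'⟩ h
    have := Prod.ext_iff.mp (congrArg Subtype.val (hφ.injective (e.injective h)))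
    exact Prod.ext (Subtype.ext this.2) (Subtype.ext this.1)
  let z : seqSet := ⟨0, Or.inl rfl⟩
  let zs : ℕ → seqSet := fun k => ⟨1 / (k + 1), Or.inr ⟨k, rfl⟩⟩
  have hzs : Tendsto zs atTop (𝓝 z) := by
    rw [tendsto_subtype_rng]
    exact tendsto_one_div_add_atTop_nhds_zero_nat
  obtain ⟨p, hp⟩ := joinedIn_swap_stdTriod
  let γ : C(I, stdTriod × stdTriod) :=
    ⟨fun u => (⟨(p u).1, (hp u).1⟩, ⟨(p u).2, (hp u).2.1⟩), by fun_prop⟩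
  have hγ : γ 1 = (γ 0).swap := by simp [γ]
  have hγne : ∀ u, (γ u).1 ≠ (γ u).2 := fun u h => (hp u).2.2 (congrArg Subtype.val h)
  obtain ⟨u₀, -, hu₀⟩ := isCompact_univ.exists_isMinOn (univ_nonempty (α := I))
    (f := fun u => ‖F.curry z (γ u).1 - F.curry z (γ u).2‖) (by fun_prop)
  have hpos : 0 < ‖F.curry z (γ u₀).1 - F.curry z (γ u₀).2‖ := by
    rw [norm_pos_iff, sub_ne_zero]
    exact fun h => hγne u₀ (congrArg Prod.snd (Finj h))
  have hlim : Tendsto (fun k => F.curry (zs k)) atTop (𝓝 (F.curry z)) :=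
    (F.curry.continuous.tendsto z).comp hzs
  obtain ⟨k, hk⟩ := ((Metric.tendsto_nhds.mp hlim) _ hpos).exists
  obtain ⟨s, t, hst⟩ := exists_eq_of_swap_path (F.curry z) (F.curry (zs k)) γ hγ fun s u => by
    rw [← dist_eq_norm]
    refine (ContinuousMap.dist_apply_le_dist s).trans_lt ?_
    rw [dist_comm]
    exact hk.trans_le (hu₀ (mem_univ u))
  have h := congrArg (fun q => (q.1 : ℝ)) (Finj hst)
  simp only [z, zs] at h
  have : (0 : ℝ) < 1 / (k + 1) := by positivity
  linarith

theorem homotopic_of_segment_subset {X E : Type*} [TopologicalSpace X] [AddCommGroup E]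
    [Module ℝ E] [TopologicalSpace E] [IsTopologicalAddGroup E] [ContinuousSMul ℝ E] {S : Set E}
    (f g : C(X, S)) (h : ∀ a, segment ℝ (f a : E) (g a) ⊆ S) : f.Homotopic g := by
  refine ⟨⟨⟨fun q => ⟨(1 - (q.1 : ℝ)) • (f q.2 : E) + (q.1 : ℝ) • (g q.2 : E), h q.2 ?_⟩, ?_⟩,
    fun a => ?_, fun a => ?_⟩⟩
  · exact ⟨1 - q.1, q.1, by linarith [q.1.2.2], q.1.2.1, by ring, rfl⟩
  · fun_prop
  · ext; simp
  · ext; simp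

/-- A triod retracts along segments onto any of its legs, in particular onto a convex set
containing a prescribed point. -/
theorem exists_retraction_stdTriod {x : ℝ × ℝ} (hx : x ∈ stdTriod) :
    ∃ q : ℝ × ℝ → ℝ × ℝ, Continuous q ∧ q x = x ∧ ∀ p ∈ stdTriod,
      segment ℝ p (q p) ⊆ stdTriod ∧ segment ℝ (q p) x ⊆ stdTriod := by
  have key : ∀ q : ℝ × ℝ → ℝ × ℝ, Continuous q → q x = x →
      (∀ p ∈ stdTriod, ∀ θ : ℝ, 0 ≤ θ → θ ≤ 1 →
        p + θ • (q p - p) ∈ stdTriod ∧ q p + θ • (x - q p) ∈ stdTriod) →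
      ∃ q : ℝ × ℝ → ℝ × ℝ, Continuous q ∧ q x = x ∧ ∀ p ∈ stdTriod,
        segment ℝ p (q p) ⊆ stdTriod ∧ segment ℝ (q p) x ⊆ stdTriod := by
    refine fun q hq hqx h => ⟨q, hq, hqx, fun p hp => ?_⟩
    simp only [segment_eq_image']
    constructor
    · rintro _ ⟨θ, ⟨h0, h1⟩, rfl⟩
      exact (h p hp θ h0 h1).1
    · rintro _ ⟨θ, ⟨h0, h1⟩, rfl⟩
      exact (h p hp θ h0 h1).2
  obtain ⟨a, b⟩ := x
  rcases mem_stdTriod.mp hx with ⟨h0, h1, h2⟩ | ⟨h0, h1, h2⟩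
  · obtain rfl : b = 0 := h0
    refine key (fun p => (p.1, 0)) (by fun_prop) rfl ?_
    rintro ⟨c, d⟩ hp θ hθ0 hθ1
    simp only [mem_stdTriod] at *
    simp only [Prod.fst_add, Prod.snd_add, Prod.smul_mk, Prod.mk_sub_mk, smul_eq_mul] at *
    constructor
    · rcases hp with ⟨rfl, h3, h4⟩ | ⟨rfl, h3, h4⟩
      · left; refine ⟨by ring, by linarith, by linarith⟩
      · right; refine ⟨by ring, by nlinarith, by nlinarith⟩
    · have hc : -1 ≤ c ∧ c ≤ 1 := by grind
      left; refine ⟨by ring, by nlinarith, by nlinarith⟩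
  · obtain rfl : a = 0 := h0
    refine key (fun p => (0, p.2)) (by fun_prop) rfl ?_
    rintro ⟨c, d⟩ hp θ hθ0 hθ1
    simp only [mem_stdTriod] at *
    simp only [Prod.fst_add, Prod.snd_add, Prod.smul_mk, Prod.mk_sub_mk, smul_eq_mul] at *
    constructor
    · rcases hp with ⟨rfl, h3, h4⟩ | ⟨rfl, h3, h4⟩
      · left; refine ⟨by ring, by nlinarith, by nlinarith⟩
      · right; refine ⟨by ring, by linarith, by linarith⟩
    · have hd : 0 ≤ d ∧ d ≤ 1 := by grind
      right; refine ⟨by ring, by nlinarith, by nlinarith⟩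

theorem seqSet_subset_Icc : seqSet ⊆ Icc 0 1 := by
  rintro _ (rfl | ⟨k, rfl⟩)
  · simp
  · refine ⟨by positivity, ?_⟩
    rw [div_le_one (by positivity)]
    linarith [k.cast_nonneg (α := ℝ)]

theorem snd_mem_Icc_of_mem_weirdSpace {x : ℝ × ℝ} {y : (ℝ × ℝ) × ℝ} (hy : y ∈ weirdSpace x) :
    y.2 ∈ Icc (0 : ℝ) 1 :=
  hy.elim (fun h => seqSet_subset_Icc h.2) fun h => h.2

theorem fst_mem_stdTriod_of_mem_weirdSpace {x : ℝ × ℝ} (hx : x ∈ stdTriod) {y : (ℝ × ℝ) × ℝ}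
    (hy : y ∈ weirdSpace x) : y.1 ∈ stdTriod :=
  hy.elim (fun h => h.1) fun h => by rwa [show y.1 = x from h.1]

theorem fst_eq_of_mem_weirdSpace {x : ℝ × ℝ} {y : (ℝ × ℝ) × ℝ} (hy : y ∈ weirdSpace x)
    (h : y.2 ∉ seqSet) : y.1 = x :=
  hy.elim (fun h' => absurd h'.2 h) fun h => h.1

theorem segment_prod_subset {E : Type*} [AddCommGroup E] [Module ℝ E] {p q : E} {t : ℝ}
    {S : Set E} (h : segment ℝ p q ⊆ S) : segment ℝ (p, t) (q, t) ⊆ S ×ˢ {t} := by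
  rw [← Prod.image_mk_segment_left]
  rintro _ ⟨r, hr, rfl⟩
  exact ⟨h hr, rfl⟩

theorem contractibleSpace_weirdSpace {x : ℝ × ℝ} (hx : x ∈ stdTriod) :
    ContractibleSpace (weirdSpace x) := by
  obtain ⟨q, hq, hqx, hseg⟩ := exists_retraction_stdTriod hx
  have hseg₁ : ∀ y ∈ weirdSpace x, segment ℝ y (q y.1, y.2) ⊆ weirdSpace x := by
    rintro ⟨p, t⟩ (⟨hp, ht⟩ | ⟨hp, ht⟩)
    · refine (segment_prod_subset (hseg p hp).1).trans ?_
      rintro ⟨r, s⟩ ⟨hr, rfl⟩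
      exact Or.inl ⟨hr, ht⟩
    · obtain rfl : p = x := hp
      simp only [hqx, segment_same, singleton_subset_iff]
      exact Or.inr ⟨rfl, ht⟩
  have hseg₂ : ∀ y ∈ weirdSpace x, segment ℝ (q y.1, y.2) (x, y.2) ⊆ weirdSpace x := by
    rintro ⟨p, t⟩ (⟨hp, ht⟩ | ⟨hp, ht⟩)
    · refine (segment_prod_subset (hseg p hp).2).trans ?_
      rintro ⟨r, s⟩ ⟨hr, rfl⟩
      exact Or.inl ⟨hr, ht⟩
    · obtain rfl : p = x := hp
      simp only [hqx, segment_same, singleton_subset_iff]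
      exact Or.inr ⟨rfl, ht⟩
  have hcol : ({x} ×ˢ Icc (0 : ℝ) 1 : Set ((ℝ × ℝ) × ℝ)) ⊆ weirdSpace x := subset_union_right
  have hzero : (x, (0 : ℝ)) ∈ weirdSpace x := hcol ⟨rfl, by simp⟩
  rw [contractible_iff_id_nullhomotopic]
  let toLeg : C(weirdSpace x, weirdSpace x) :=
    ⟨fun y => ⟨(q y.1.1, y.1.2), hseg₁ y y.2 (right_mem_segment ℝ _ _)⟩, by fun_prop⟩
  let toColumn : C(weirdSpace x, weirdSpace x) :=
    ⟨fun y => ⟨(x, y.1.2), hseg₂ y y.2 (right_mem_segment ℝ _ _)⟩, by fun_prop⟩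
  refine ⟨⟨_, hzero⟩, (homotopic_of_segment_subset _ toLeg fun y => hseg₁ y y.2).trans
    ((homotopic_of_segment_subset toLeg toColumn fun y => hseg₂ y y.2).trans
    (homotopic_of_segment_subset toColumn _ fun y => ?_))⟩
  have hy : (toColumn y : (ℝ × ℝ) × ℝ) ∈ ({x} : Set (ℝ × ℝ)) ×ˢ Icc (0 : ℝ) 1 :=
    ⟨rfl, snd_mem_Icc_of_mem_weirdSpace (toColumn y).2⟩
  have h0 : (x, (0 : ℝ)) ∈ ({x} : Set (ℝ × ℝ)) ×ˢ Icc (0 : ℝ) 1 := ⟨rfl, by simp⟩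
  exact (((convex_singleton x).prod (convex_Icc 0 1)).segment_subset hy h0).trans hcol

theorem inter_inter_eq_empty_of_pairwiseDisjoint {X : Type*} {𝒜 ℬ : Set (Set X)}
    (hA : 𝒜.PairwiseDisjoint id) (hB : ℬ.PairwiseDisjoint id) {U V W : Set X} (hU : U ∈ 𝒜 ∪ ℬ)
    (hV : V ∈ 𝒜 ∪ ℬ) (hW : W ∈ 𝒜 ∪ ℬ) (hUV : U ≠ V) (hUW : U ≠ W) (hVW : V ≠ W) :
    U ∩ V ∩ W = ∅ := by
  have key : ∀ {P Q : Set X}, P ≠ Q → (P ∈ 𝒜 ∧ Q ∈ 𝒜 ∨ P ∈ ℬ ∧ Q ∈ ℬ) → P ∩ Q = ∅ :=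
    fun hne h => h.elim (fun h => (hA h.1 h.2 hne).inter_eq) fun h => (hB h.1 h.2 hne).inter_eq
  have h : U ∩ V = ∅ ∨ U ∩ W = ∅ ∨ V ∩ W = ∅ := by
    rcases hU with hU | hU <;> rcases hV with hV | hV <;> rcases hW with hW | hW <;> grind
  grind

theorem eq_of_mem_Ioo_mul {δ s : ℝ} (hδ : 0 < δ) {k l : ℤ}
    (hk : s ∈ Ioo (δ * k) (δ * (k + 1))) (hl : s ∈ Ioo (δ * l) (δ * (l + 1))) : k = l := by
  have h1 : (k : ℝ) < l + 1 := lt_of_mul_lt_mul_left (hk.1.trans hl.2) hδ.le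
  have h2 : (l : ℝ) < k + 1 := lt_of_mul_lt_mul_left (hl.1.trans hk.2) hδ.le
  norm_cast at h1 h2
  lia

theorem eq_of_abs_sub_mul_lt {δ s : ℝ} (hδ : 0 < δ) {k l : ℤ}
    (hk : |s - δ * k| < δ / 3) (hl : |s - δ * l| < δ / 3) : k = l := by
  rw [abs_lt] at hk hl
  have h1 : (k : ℝ) < l + 1 := lt_of_mul_lt_mul_left (by linarith : δ * k < δ * (l + 1)) hδ.le
  have h2 : (l : ℝ) < k + 1 := lt_of_mul_lt_mul_left (by linarith : δ * l < δ * (k + 1)) hδ.le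
  norm_cast at h1 h2
  lia

theorem exists_eq_mul_or_mem_Ioo {δ : ℝ} (hδ : 0 < δ) (s : ℝ) :
    ∃ k : ℤ, s = δ * k ∨ s ∈ Ioo (δ * k) (δ * (k + 1)) := by
  refine ⟨⌊s / δ⌋, ?_⟩
  have h1 := Int.floor_le (s / δ)
  have h2 := Int.lt_floor_add_one (s / δ)
  rw [le_div_iff₀ hδ] at h1
  rw [div_lt_iff₀ hδ] at h2
  rcases h1.eq_or_lt with h | h
  · left; linarith
  · right; constructor <;> linarith

theorem mul_notMem_Ioo {δ : ℝ} (hδ : 0 < δ) (k l : ℤ) :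
    δ * k ∉ Ioo (δ * l) (δ * (l + 1)) := by
  rintro ⟨h1, h2⟩
  have h1 : (l : ℝ) < k := lt_of_mul_lt_mul_left h1 hδ.le
  have h2 : (k : ℝ) < l + 1 := lt_of_mul_lt_mul_left h2 hδ.le
  norm_cast at h1 h2
  lia

theorem exists_pos_lt_dvd {c ε : ℝ} (hε : 0 < ε) : ∃ δ, 0 < δ ∧ δ < ε ∧ ∃ k : ℤ, c = δ * k := by
  obtain ⟨n, hn⟩ := exists_nat_gt (|c| / ε)
  rcases eq_or_ne c 0 with rfl | hc
  · exact ⟨ε / 2, by linarith, by linarith, 0, by simp⟩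
  have hc' : 0 < |c| := abs_pos.mpr hc
  have hn0 : (0 : ℝ) < n := (by positivity : 0 < |c| / ε).trans hn
  refine ⟨|c| / n, by positivity, ?_, ?_⟩
  · rw [div_lt_iff₀ hε] at hn
    rw [div_lt_iff₀ hn0]
    linarith
  · rcases abs_choice c with h | h
    · exact ⟨n, by rw [h]; push_cast; field_simp⟩
    · exact ⟨-n, by rw [h]; push_cast; field_simp⟩

theorem countable_seqSet : seqSet.Countable := (countable_singleton 0).union (countable_range _)

theorem exists_shift_notMem_seqSet (δ : ℝ) : ∃ ω : ℝ, ∀ k : ℤ, δ * k + ω ∉ seqSet := by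
  have h : (⋃ k : ℤ, (fun s => s - δ * k) '' seqSet).Countable :=
    countable_iUnion fun k => countable_seqSet.image _
  obtain ⟨ω, hω⟩ := (h.dense_compl ℝ).nonempty
  refine ⟨ω, fun k hk => hω (mem_iUnion.mpr ⟨k, _, hk, by ring⟩)⟩

theorem exists_mesh_stdTriod {x : ℝ × ℝ} (hx : x ∈ stdTriod) {ε : ℝ} (hε : 0 < ε) :
    ∃ δ, 0 < δ ∧ δ < ε ∧ ∃ i j : ℤ, x = (δ * i, δ * j) := by
  obtain ⟨a, b⟩ := x
  rcases mem_stdTriod.mp hx with ⟨h, -⟩ | ⟨h, -⟩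
  · obtain ⟨δ, h0, h1, k, hk⟩ := exists_pos_lt_dvd (c := a) hε
    exact ⟨δ, h0, h1, k, 0, by simp_all⟩
  · obtain ⟨δ, h0, h1, k, hk⟩ := exists_pos_lt_dvd (c := b) hε
    exact ⟨δ, h0, h1, 0, k, by simp_all⟩

theorem diam_subtype_lt_of_abs_sub_le {S : Set ((ℝ × ℝ) × ℝ)} {U : Set S} {δ ε : ℝ} (hδ : 0 ≤ δ)
    (hε : δ < ε) (h : ∀ y ∈ U, ∀ z ∈ U, |y.1.1.1 - z.1.1.1| ≤ δ ∧ |y.1.1.2 - z.1.1.2| ≤ δ ∧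
      |y.1.2 - z.1.2| ≤ δ) : Metric.diam U < ε := by
  refine (Metric.diam_le_of_forall_dist_le hδ fun y hy z hz => ?_).trans_lt hε
  obtain ⟨h1, h2, h3⟩ := h y hy z hz
  rw [Subtype.dist_eq, Prod.dist_eq, Prod.dist_eq, Real.dist_eq, Real.dist_eq, Real.dist_eq]
  exact max_le (max_le h1 h2) h3

/-- Small open sets cover the space by two families of pairwise disjoint sets: neighbourhoods of
the vertices of a subdivision of the triod, and open edges of that subdivision together with
short subarcs of the column over `x`. -/
theorem exists_disjoint_families_weirdSpace {x : ℝ × ℝ} (hx : x ∈ stdTriod) {ε : ℝ}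
    (hε : 0 < ε) : ∃ 𝒜 ℬ : Set (Set (weirdSpace x)), 𝒜.PairwiseDisjoint id ∧
      ℬ.PairwiseDisjoint id ∧ (∀ U ∈ 𝒜 ∪ ℬ, IsOpen U ∧ Metric.diam U < ε) ∧
      ⋃₀ (𝒜 ∪ ℬ) = univ := by
  obtain ⟨δ, hδ, hδε, i₀, j₀, hxδ⟩ := exists_mesh_stdTriod hx hε
  obtain ⟨ω, hω⟩ := exists_shift_notMem_seqSet δ
  have hT : ∀ y : weirdSpace x, y.1.1.1 = 0 ∨ y.1.1.2 = 0 := fun y =>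
    (mem_stdTriod.mp (fst_mem_stdTriod_of_mem_weirdSpace hx y.2)).elim (fun h => Or.inr h.1)
      fun h => Or.inl h.1
  have hcol : ∀ y : weirdSpace x, y.1.2 ∉ seqSet → y.1.1.1 = δ * i₀ ∧ y.1.1.2 = δ * j₀ :=
    fun y h => by rw [fst_eq_of_mem_weirdSpace y.2 h, hxδ]; exact ⟨rfl, rfl⟩
  have hzero : ∀ k : ℤ, (0 : ℝ) ∉ Ioo (δ * k) (δ * (k + 1)) := fun k => by
    simpa using mul_notMem_Ioo hδ 0 k
  let slab : ℤ → Set (weirdSpace x) := fun k => {y | y.1.2 - ω ∈ Ioo (δ * k) (δ * (k + 1))}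
  let vert : ℤ × ℤ × ℤ → Set (weirdSpace x) := fun n =>
    {y | |y.1.1.1 - δ * n.1| < δ / 3 ∧ |y.1.1.2 - δ * n.2.1| < δ / 3} ∩ slab n.2.2
  let hor : ℤ × ℤ → Set (weirdSpace x) := fun n =>
    {y | y.1.1.1 ∈ Ioo (δ * n.1) (δ * (n.1 + 1))} ∩ slab n.2
  let ver : ℤ × ℤ → Set (weirdSpace x) := fun n =>
    {y | y.1.1.2 ∈ Ioo (δ * n.1) (δ * (n.1 + 1))} ∩ slab n.2
  let arc : ℤ → Set (weirdSpace x) := fun k => {y | |y.1.2 - ω - δ * k| < δ / 3 ∧ y.1.2 ∉ seqSet}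
  have slab_open : ∀ k, IsOpen (slab k) := fun k =>
    isOpen_Ioo.preimage (by fun_prop : Continuous fun y : weirdSpace x => y.1.2 - ω)
  have vert_open : ∀ n, IsOpen (vert n) := fun n =>
    ((isOpen_Iio.preimage
        (by fun_prop : Continuous fun y : weirdSpace x => |y.1.1.1 - δ * n.1|)).inter
      (isOpen_Iio.preimage
        (by fun_prop : Continuous fun y : weirdSpace x => |y.1.1.2 - δ * n.2.1|))).inter
      (slab_open _)
  have hor_open : ∀ n, IsOpen (hor n) := fun n =>
    (isOpen_Ioo.preimage (by fun_prop : Continuous fun y : weirdSpace x => y.1.1.1)).inter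
      (slab_open _)
  have ver_open : ∀ n, IsOpen (ver n) := fun n =>
    (isOpen_Ioo.preimage (by fun_prop : Continuous fun y : weirdSpace x => y.1.1.2)).inter
      (slab_open _)
  have arc_open : ∀ k, IsOpen (arc k) := fun k =>
    (isOpen_Iio.preimage
        (by fun_prop : Continuous fun y : weirdSpace x => |y.1.2 - ω - δ * k|)).inter
      (isCompact_seqSet.isClosed.isOpen_compl.preimage
        (by fun_prop : Continuous fun y : weirdSpace x => y.1.2))
  have of_common : ∀ {U V : Set (weirdSpace x)}, (∀ y ∈ U, y ∈ V → U = V) → U ≠ V →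
      Disjoint U V := fun h hne => disjoint_left.mpr fun y hU hV => hne (h y hU hV)
  refine ⟨range vert, range hor ∪ range ver ∪ range arc, ?_, ?_, ?_, ?_⟩
  · rintro _ ⟨n, rfl⟩ _ ⟨m, rfl⟩
    refine of_common ?_
    rintro y ⟨⟨h1, h2⟩, h3⟩ ⟨⟨h1', h2'⟩, h3'⟩
    rw [Prod.ext (eq_of_abs_sub_mul_lt hδ h1 h1') (Prod.ext (eq_of_abs_sub_mul_lt hδ h2 h2')
      (eq_of_mem_Ioo_mul hδ h3 h3'))]
  · have hor_ver : ∀ n m, ∀ y ∈ hor n, y ∉ ver m := by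
      rintro n m y ⟨h, -⟩ ⟨h', -⟩
      rcases hT y with h0 | h0
      · exact hzero n.1 (h0 ▸ h)
      · exact hzero m.1 (h0 ▸ h')
    have hor_arc : ∀ n k, ∀ y ∈ hor n, y ∉ arc k := by
      rintro n k y ⟨h, -⟩ ⟨-, h'⟩
      exact mul_notMem_Ioo hδ i₀ n.1 ((hcol y h').1 ▸ h)
    have ver_arc : ∀ n k, ∀ y ∈ ver n, y ∉ arc k := by
      rintro n k y ⟨h, -⟩ ⟨-, h'⟩
      exact mul_notMem_Ioo hδ j₀ n.1 ((hcol y h').2 ▸ h)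
    rintro _ ((⟨n, rfl⟩ | ⟨n, rfl⟩) | ⟨n, rfl⟩) _ ((⟨m, rfl⟩ | ⟨m, rfl⟩) | ⟨m, rfl⟩) <;>
      refine of_common fun y hU hV => ?_
    · rw [Prod.ext (eq_of_mem_Ioo_mul hδ hU.1 hV.1)
        (eq_of_mem_Ioo_mul hδ hU.2 hV.2)]
    · exact absurd hV (hor_ver n m y hU)
    · exact absurd hV (hor_arc n m y hU)
    · exact absurd hU (hor_ver m n y hV)
    · rw [Prod.ext (eq_of_mem_Ioo_mul hδ hU.1 hV.1)
        (eq_of_mem_Ioo_mul hδ hU.2 hV.2)]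
    · exact absurd hV (ver_arc n m y hU)
    · exact absurd hU (hor_arc m n y hV)
    · exact absurd hU (ver_arc m n y hV)
    · rw [eq_of_abs_sub_mul_lt hδ hU.1 hV.1]
  · have near : ∀ {s t c : ℝ}, |s - c| < δ / 3 → |t - c| < δ / 3 → |s - t| ≤ δ := by
      intro s t c h h'
      rw [abs_lt] at h h'
      rw [abs_le]
      constructor <;> linarith
    have gap : ∀ {s t : ℝ} {k : ℤ}, s ∈ Ioo (δ * k) (δ * (k + 1)) →
        t ∈ Ioo (δ * k) (δ * (k + 1)) → |s - t| ≤ δ := by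
      rintro s t k ⟨h1, h2⟩ ⟨h1', h2'⟩
      rw [abs_le]
      constructor <;> linarith
    have slab_near : ∀ {k} {y z : weirdSpace x}, y ∈ slab k → z ∈ slab k →
        |y.1.2 - z.1.2| ≤ δ := fun {k y z} h h' => by simpa using gap h h'
    have same : ∀ {s t : ℝ}, s = t → |s - t| ≤ δ := fun h => by simp [h, hδ.le]
    rintro _ (⟨n, rfl⟩ | ((⟨n, rfl⟩ | ⟨n, rfl⟩) | ⟨n, rfl⟩))
    · exact ⟨vert_open n, diam_subtype_lt_of_abs_sub_le hδ.le hδε fun y hy z hz =>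
        ⟨near hy.1.1 hz.1.1, near hy.1.2 hz.1.2, slab_near hy.2 hz.2⟩⟩
    · have h0 : ∀ y ∈ hor n, y.1.1.2 = 0 := fun y hy =>
        (hT y).resolve_left fun h => hzero n.1 (h ▸ hy.1)
      exact ⟨hor_open n, diam_subtype_lt_of_abs_sub_le hδ.le hδε fun y hy z hz =>
        ⟨gap hy.1 hz.1, same ((h0 y hy).trans (h0 z hz).symm), slab_near hy.2 hz.2⟩⟩
    · have h0 : ∀ y ∈ ver n, y.1.1.1 = 0 := fun y hy =>
        (hT y).resolve_right fun h => hzero n.1 (h ▸ hy.1)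
      exact ⟨ver_open n, diam_subtype_lt_of_abs_sub_le hδ.le hδε fun y hy z hz =>
        ⟨same ((h0 y hy).trans (h0 z hz).symm), gap hy.1 hz.1, slab_near hy.2 hz.2⟩⟩
    · exact ⟨arc_open n, diam_subtype_lt_of_abs_sub_le hδ.le hδε fun y hy z hz =>
        ⟨same ((hcol y hy.2).1.trans (hcol z hz.2).1.symm),
          same ((hcol y hy.2).2.trans (hcol z hz.2).2.symm), by simpa using near hy.1 hz.1⟩⟩
  · refine eq_univ_of_forall fun y => ?_
    obtain ⟨k, hk | hk⟩ := exists_eq_mul_or_mem_Ioo hδ (y.1.2 - ω)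
    · refine ⟨arc k, Or.inr (Or.inr ⟨k, rfl⟩), by simp [hk, hδ], ?_⟩
      rw [show y.1.2 = δ * k + ω by linarith]
      exact hω k
    obtain ⟨i, hi | hi⟩ := exists_eq_mul_or_mem_Ioo hδ y.1.1.1
    · obtain ⟨j, hj | hj⟩ := exists_eq_mul_or_mem_Ioo hδ y.1.1.2
      · exact ⟨vert (i, j, k), Or.inl ⟨_, rfl⟩, ⟨by simp [hi, hδ], by simp [hj, hδ]⟩, hk⟩
      · exact ⟨ver (j, k), Or.inr (Or.inl (Or.inr ⟨_, rfl⟩)), hj, hk⟩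
    · exact ⟨hor (i, k), Or.inr (Or.inl (Or.inl ⟨_, rfl⟩)), hi, hk⟩

theorem contractible_one_dimensional_nonplanar_compactum
    (x : ℝ × ℝ) (hx : x ∈ stdTriod) :
    IsCompact (weirdSpace x) ∧
    ContractibleSpace (weirdSpace x) ∧
    (∀ ε : ℝ, 0 < ε → ∃ 𝒰 : Set (Set (weirdSpace x)),
      (∀ U ∈ 𝒰, IsOpen U ∧ Metric.diam U < ε) ∧ ⋃₀ 𝒰 = univ ∧
      ∀ U ∈ 𝒰, ∀ V ∈ 𝒰, ∀ W ∈ 𝒰, U ≠ V → U ≠ W → V ≠ W → U ∩ V ∩ W = ∅) ∧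
    ¬∃ f : weirdSpace x → ℝ × ℝ, Topology.IsEmbedding f := by
  refine ⟨isCompact_weirdSpace x, contractibleSpace_weirdSpace hx, fun ε hε => ?_,
    fun ⟨φ, hφ⟩ => not_isEmbedding_weirdSpace x φ hφ⟩
  obtain ⟨𝒜, ℬ, hA, hB, hsmall, hcover⟩ := exists_disjoint_families_weirdSpace hx hε
  exact ⟨𝒜 ∪ ℬ, hsmall, hcover, fun U hU V hV W hW =>
    inter_inter_eq_empty_of_pairwiseDisjoint hA hB hU hV hW⟩
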